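/- There exists a function φ : ℝ_{>0} → ℝ_{>0} such that for every c > 0, every n ∈ ℕ with n ≥ 1, every k ∈ ℤ and every ε ∈ [-1,1] satisfying |ε| ≤ c·√(log n / n) and |k| < c·√(n·log n), it holds that |V(n,ε)(k) − Φ((k−εn)/√n)| ≤ φ(c)·(log^{1.5} n / √n)·e^{-(k−εn)²/(2n)}. -/

import Mathlib

noncomputable def binPMF (n : ℕ) (ε : ℝ) (k : ℤ) : ℝ :=
  if ((n : ℤ) + k) % 2 = 0 ∧ -(n : ℤ) ≤ k ∧ k ≤ (n : ℤ) then
    (n.choose (((n : ℤ) + k) / 2).toNat : ℝ) *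
      ((1 + ε) / 2) ^ (((n : ℤ) + k) / 2).toNat *
      ((1 - ε) / 2) ^ (((n : ℤ) - k) / 2).toNat
  else 0

noncomputable def binTail (n : ℕ) (ε : ℝ) (k : ℤ) : ℝ :=
  ∑ t ∈ Finset.Icc k (n : ℤ), binPMF n ε t

noncomputable def stdGaussTail (x : ℝ) : ℝ :=
  (Real.sqrt (2 * Real.pi))⁻¹ * ∫ t in Set.Ioi x, Real.exp (-t ^ 2 / 2)

noncomputable def stdGaussTailInv : ℝ → ℝ := Function.invFun stdGaussTail

/-- The probability of exactly `j` heads in `n` independent tosses of bias `ε`. -/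
noncomputable def headPMF (n : ℕ) (ε : ℝ) (j : ℕ) : ℝ :=
  (n.choose j : ℝ) * ((1 + ε) / 2) ^ j * ((1 - ε) / 2) ^ (n - j)

/-- The unnormalised standard Gaussian density. -/
noncomputable def gaussKernel (s : ℝ) : ℝ := Real.exp (-s ^ 2 / 2)

lemma headPMF_nonneg {n : ℕ} {ε : ℝ} (hε : ε ∈ Set.Icc (-1 : ℝ) 1) (j : ℕ) :
    0 ≤ headPMF n ε j := by
  have h1 : 0 ≤ (1 + ε) / 2 := by linarith [hε.1]
  have h2 : 0 ≤ (1 - ε) / 2 := by linarith [hε.2]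
  unfold headPMF
  positivity

lemma binTail_eq_sum_headPMF (n : ℕ) (ε : ℝ) (k : ℤ) (hk : -(n : ℤ) ≤ k) :
    binTail n ε k = ∑ j ∈ Finset.Ico ((n + k + 1) / 2).toNat (n + 1), headPMF n ε j := by
  unfold binTail binPMF
  rw [← Finset.sum_filter]
  symm
  refine Finset.sum_nbij' (fun j : ℕ => 2 * (j : ℤ) - n) (fun t : ℤ => ((n + t) / 2).toNat)
    ?_ ?_ ?_ ?_ ?_
  · intro j hj
    simp only [Finset.mem_Ico] at hj
    simp only [Finset.mem_filter, Finset.mem_Icc]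
    omega
  · intro t ht
    simp only [Finset.mem_filter, Finset.mem_Icc] at ht
    simp only [Finset.mem_Ico]
    omega
  · intro j hj
    simp only [Finset.mem_Ico] at hj
    omega
  · intro t ht
    simp only [Finset.mem_filter, Finset.mem_Icc] at ht
    omega
  · intro j hj
    simp only [Finset.mem_Ico] at hj
    have h1 : (((n : ℤ) + (2 * (j : ℤ) - n)) / 2).toNat = j := by omega
    have h2 : (((n : ℤ) - (2 * (j : ℤ) - n)) / 2).toNat = n - j := by omega
    simp only [h1, h2, headPMF]

lemma sum_headPMF_mul_exp (n : ℕ) (ε s : ℝ) :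
    ∑ j ∈ Finset.range (n + 1), headPMF n ε j * Real.exp (s * (2 * j - n)) =
      ((1 + ε) / 2 * Real.exp s + (1 - ε) / 2 * Real.exp (-s)) ^ n := by
  rw [add_pow]
  refine Finset.sum_congr rfl fun j hj => ?_
  have hj' : j ≤ n := by simpa [Nat.lt_succ_iff] using hj
  have h : Real.exp (s * (2 * j - n)) = Real.exp s ^ j * Real.exp (-s) ^ (n - j) := by
    rw [← Real.exp_nat_mul, ← Real.exp_nat_mul, ← Real.exp_add, Nat.cast_sub hj']
    ring_nf
  rw [h, headPMF, mul_pow, mul_pow]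
  ring

lemma sum_headPMF (n : ℕ) (ε : ℝ) : ∑ j ∈ Finset.range (n + 1), headPMF n ε j = 1 := by
  have h := sum_headPMF_mul_exp n ε 0
  simp only [zero_mul, Real.exp_zero, mul_one, neg_zero] at h
  rw [h]
  ring_nf

lemma bernoulli_mgf_le {ε s : ℝ} (hε : ε ∈ Set.Icc (-1 : ℝ) 1) (hs : |s| ≤ 1) :
    (1 + ε) / 2 * Real.exp s + (1 - ε) / 2 * Real.exp (-s) ≤ Real.exp (ε * s + s ^ 2) := by
  have h1 := abs_le.1 (Real.abs_exp_sub_one_sub_id_le hs)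
  have h2 := abs_le.1 (Real.abs_exp_sub_one_sub_id_le (x := -s) (by rwa [abs_neg]))
  have h3 := Real.add_one_le_exp (ε * s + s ^ 2)
  nlinarith [hε.1, hε.2, h1.2, h2.2, mul_le_mul_of_nonneg_left h1.2 (by linarith [hε.1] : 0 ≤ 1 + ε),
    mul_le_mul_of_nonneg_left h2.2 (by linarith [hε.2] : 0 ≤ 1 - ε)]

/-- Chernoff bound on any set of outcomes on which `s * (2 j - n)` is at least `R`. -/
lemma sum_headPMF_le_exp {n : ℕ} {ε s R : ℝ} (hε : ε ∈ Set.Icc (-1 : ℝ) 1) (hs : |s| ≤ 1)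
    {A : Finset ℕ} (hA : A ⊆ Finset.range (n + 1)) (hR : ∀ j ∈ A, R ≤ s * (2 * j - n)) :
    ∑ j ∈ A, headPMF n ε j ≤ Real.exp (n * (ε * s + s ^ 2) - R) := by
  have hmgf : ∑ j ∈ Finset.range (n + 1), headPMF n ε j * Real.exp (s * (2 * j - n)) ≤
      Real.exp (n * (ε * s + s ^ 2)) := by
    rw [sum_headPMF_mul_exp, Real.exp_nat_mul]
    refine pow_le_pow_left₀ ?_ (bernoulli_mgf_le hε hs) n
    have h1 : 0 ≤ (1 + ε) / 2 := by linarith [hε.1]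
    have h2 : 0 ≤ (1 - ε) / 2 := by linarith [hε.2]
    positivity
  rw [Real.exp_sub, le_div_iff₀ (Real.exp_pos R), Finset.sum_mul]
  calc ∑ j ∈ A, headPMF n ε j * Real.exp R
      ≤ ∑ j ∈ A, headPMF n ε j * Real.exp (s * (2 * j - n)) :=
        Finset.sum_le_sum fun j hj => mul_le_mul_of_nonneg_left
          (Real.exp_le_exp.2 (hR j hj)) (headPMF_nonneg hε j)
    _ ≤ ∑ j ∈ Finset.range (n + 1), headPMF n ε j * Real.exp (s * (2 * j - n)) :=
        Finset.sum_le_sum_of_subset_of_nonneg hA fun j _ _ =>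
          mul_nonneg (headPMF_nonneg hε j) (Real.exp_pos _).le
    _ ≤ _ := hmgf

lemma abs_log_one_add_sub_le {u : ℝ} (hu : |u| ≤ 1 / 2) : |Real.log (1 + u) - u| ≤ 2 * u ^ 2 := by
  obtain ⟨h1, h2⟩ := abs_le.1 hu
  have hpos : 0 < 1 + u := by linarith
  have hupper := Real.log_le_sub_one_of_pos hpos
  have hlower := Real.one_sub_inv_le_log_of_pos hpos
  have h3 : u - 2 * u ^ 2 ≤ 1 - (1 + u)⁻¹ := by
    have : 1 - (1 + u)⁻¹ = u / (1 + u) := by field_simp; ring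
    rw [this, le_div_iff₀ hpos]
    nlinarith [mul_nonneg (sq_nonneg u) (by linarith : 0 ≤ 1 + 2 * u)]
  rw [abs_le]
  constructor <;> nlinarith [sq_nonneg u]

/-- The argument of the Gaussian kernel corresponding to `j` heads. -/
noncomputable def headScore (n : ℕ) (ε : ℝ) (j : ℕ) : ℝ := (2 * j - n - ε * n) / Real.sqrt n

lemma headPMF_succ_log_ratio {n j : ℕ} {ε R : ℝ} (hn : 1 ≤ n) (hR : R ≤ 1 / 2) (hε : |ε| ≤ R)
    (h1 : |(2 * j - n : ℝ)| ≤ R * n) (h2 : |(2 * (j + 1) - n : ℝ)| ≤ R * n) :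
    ∃ z : ℝ, |z| ≤ 8 * R ^ 2 ∧
      headPMF n ε (j + 1) * gaussKernel (headScore n ε j) =
        Real.exp z * (headPMF n ε j * gaussKernel (headScore n ε (j + 1))) := by
  have hn0 : (0 : ℝ) < n := by exact_mod_cast hn
  set u : ℝ := (2 * j - n) / n with hu
  set v : ℝ := (2 * (j + 1) - n) / n with hv
  have hu' : |u| ≤ R := by rw [hu, abs_div, abs_of_pos hn0, div_le_iff₀ hn0]; exact h1
  have hv' : |v| ≤ R := by rw [hv, abs_div, abs_of_pos hn0, div_le_iff₀ hn0]; exact h2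
  have hu2 := abs_le.1 hu'
  have hv2 := abs_le.1 hv'
  have hε2 := abs_le.1 hε
  have hjn : j + 1 ≤ n := by
    have : (j : ℝ) < n := by
      have : u < 1 := by linarith
      rw [hu, div_lt_one hn0] at this
      linarith
    exact_mod_cast this
  have hp1 : 0 < 1 - u := by linarith
  have hp2 : 0 < 1 + v := by linarith
  have hp3 : 0 < 1 + ε := by linarith
  have hp4 : 0 < 1 - ε := by linarith
  refine ⟨Real.log (1 - u) - Real.log (1 + v) + Real.log (1 + ε) - Real.log (1 - ε)
      + (u + v - 2 * ε), ?_, ?_⟩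
  · have e1 := abs_le.1 (abs_log_one_add_sub_le (u := -u) (by rw [abs_neg]; linarith))
    have e2 := abs_le.1 (abs_log_one_add_sub_le (u := v) (by linarith))
    have e3 := abs_le.1 (abs_log_one_add_sub_le (u := ε) (by linarith))
    have e4 := abs_le.1 (abs_log_one_add_sub_le (u := -ε) (by rw [abs_neg]; linarith))
    rw [← sub_eq_add_neg] at e1 e4
    have s1 : u ^ 2 ≤ R ^ 2 := sq_le_sq' hu2.1 hu2.2
    have s2 : v ^ 2 ≤ R ^ 2 := sq_le_sq' hv2.1 hv2.2
    have s3 : ε ^ 2 ≤ R ^ 2 := sq_le_sq' hε2.1 hε2.2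
    rw [abs_le]
    constructor <;> linarith [e1.1, e1.2, e2.1, e2.2, e3.1, e3.2, e4.1, e4.2]
  · have hchoose : (n.choose (j + 1) : ℝ) * (1 + v) = n.choose j * (1 - u) := by
      have h := congrArg (Nat.cast (R := ℝ)) (Nat.choose_succ_right_eq n j)
      rw [Nat.cast_mul, Nat.cast_mul, Nat.cast_sub (by omega : j ≤ n)] at h
      have a1 : 1 + v = 2 / n * ((j + 1 : ℕ) : ℝ) := by
        rw [hv]; push_cast; field_simp; ring
      have a2 : 1 - u = 2 / n * ((n : ℝ) - j) := by
        rw [hu]; field_simp; ring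
      rw [a1, a2]
      linear_combination (2 / (n : ℝ)) * h
    have hg : gaussKernel (headScore n ε j) =
        Real.exp (u + v - 2 * ε) * gaussKernel (headScore n ε (j + 1)) := by
      unfold gaussKernel headScore
      rw [← Real.exp_add]
      congr 1
      rw [div_pow, div_pow, Real.sq_sqrt hn0.le, hu, hv]
      push_cast
      field_simp
      ring
    rw [Real.exp_add, Real.exp_sub, Real.exp_add, Real.exp_sub, Real.exp_log hp1, Real.exp_log hp2,
      Real.exp_log hp3, Real.exp_log hp4, hg]
    unfold headPMF
    have hpow : ((1 - ε) / 2) ^ (n - j) = ((1 - ε) / 2) ^ (n - (j + 1)) * ((1 - ε) / 2) := by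
      rw [← pow_succ]; congr 1; omega
    rw [hpow, pow_succ]
    field_simp
    linear_combination hchoose * gaussKernel (headScore n ε (j + 1))

lemma gaussKernel_pos (s : ℝ) : 0 < gaussKernel s := Real.exp_pos _

lemma gaussKernel_le_one (s : ℝ) : gaussKernel s ≤ 1 :=
  Real.exp_le_one_iff.2 (by nlinarith [sq_nonneg s])

lemma continuous_gaussKernel : Continuous gaussKernel := by
  unfold gaussKernel
  fun_prop

lemma integrable_gaussKernel : MeasureTheory.Integrable gaussKernel := by
  have h := integrable_exp_neg_mul_sq (b := 1 / 2) (by norm_num)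
  refine h.congr (Filter.Eventually.of_forall fun s => ?_)
  simp only [gaussKernel]
  ring_nf

lemma stdGaussTail_eq (x : ℝ) :
    stdGaussTail x = (Real.sqrt (2 * Real.pi))⁻¹ * ∫ t in Set.Ioi x, gaussKernel t := rfl

lemma integral_Ioi_gaussKernel (y : ℝ) :
    ∫ t in Set.Ioi y, gaussKernel t = ∫ t in Set.Ioi 0, gaussKernel (t + y) := by
  have h := (MeasureTheory.measurePreserving_add_right MeasureTheory.volume y).setIntegral_preimage_emb
    (measurableEmbedding_addRight y) gaussKernel (Set.Ioi y)
  rw [← h]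
  simp

lemma integral_Ioi_zero_gaussKernel :
    ∫ t in Set.Ioi 0, gaussKernel t = Real.sqrt (2 * Real.pi) / 2 := by
  have h := integral_gaussian_Ioi (1 / 2)
  rw [show Real.pi / (1 / 2) = 2 * Real.pi by ring] at h
  rw [← h]
  refine MeasureTheory.integral_congr_ae (Filter.Eventually.of_forall fun s => ?_)
  simp only [gaussKernel]
  ring_nf

lemma sqrt_two_pi_inv_le_one : (Real.sqrt (2 * Real.pi))⁻¹ ≤ 1 := by
  refine inv_le_one_of_one_le₀ (Real.one_le_sqrt.2 ?_)
  linarith [Real.pi_gt_three]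

lemma stdGaussTail_nonneg (x : ℝ) : 0 ≤ stdGaussTail x := by
  rw [stdGaussTail_eq]
  have := MeasureTheory.setIntegral_nonneg (μ := MeasureTheory.volume) (measurableSet_Ioi (a := x))
    (fun t _ => (gaussKernel_pos t).le)
  positivity

lemma stdGaussTail_le {y : ℝ} (hy : 0 ≤ y) : stdGaussTail y ≤ gaussKernel y := by
  have hκ : 0 < Real.sqrt (2 * Real.pi) := Real.sqrt_pos.2 (by positivity)
  have h : ∫ t in Set.Ioi 0, gaussKernel (t + y) ≤
      ∫ t in Set.Ioi 0, gaussKernel y * gaussKernel t := by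
    refine MeasureTheory.setIntegral_mono_on (integrable_gaussKernel.comp_add_right y).integrableOn
      (integrable_gaussKernel.const_mul _).integrableOn measurableSet_Ioi fun t ht => ?_
    unfold gaussKernel
    rw [← Real.exp_add]
    exact Real.exp_le_exp.2 (by nlinarith [mul_nonneg (le_of_lt ht) hy])
  rw [MeasureTheory.integral_const_mul, integral_Ioi_zero_gaussKernel] at h
  rw [stdGaussTail_eq, integral_Ioi_gaussKernel, inv_mul_le_iff₀ hκ]
  nlinarith [mul_pos hκ (gaussKernel_pos y)]

lemma stdGaussTail_add_neg (x : ℝ) : stdGaussTail x + stdGaussTail (-x) = 1 := by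
  have hκ : 0 < Real.sqrt (2 * Real.pi) := Real.sqrt_pos.2 (by positivity)
  have heven : ∀ t, gaussKernel (-t) = gaussKernel t := fun t => by simp [gaussKernel]
  have hneg : ∀ y, ∫ t in Set.Ioi (-y), gaussKernel t = ∫ t in Set.Iic y, gaussKernel t :=
    fun y => by
      rw [← integral_comp_neg_Iic]
      simp only [heven]
  have hsplit : ∀ y, (∫ t in Set.Iic y, gaussKernel t) + ∫ t in Set.Ioi y, gaussKernel t =
      ∫ t, gaussKernel t := fun y =>
    intervalIntegral.integral_Iic_add_Ioi integrable_gaussKernel.integrableOn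
      integrable_gaussKernel.integrableOn
  have h0 := hneg 0
  rw [neg_zero] at h0
  have htot : ∫ t, gaussKernel t = Real.sqrt (2 * Real.pi) := by
    rw [← hsplit 0, ← h0, integral_Ioi_zero_gaussKernel]
    ring
  rw [stdGaussTail_eq, stdGaussTail_eq, hneg, ← mul_add, add_comm, hsplit, htot]
  field_simp

lemma stdGaussTail_sub_eq {s t : ℝ} (hst : s ≤ t) :
    stdGaussTail s - stdGaussTail t =
      (Real.sqrt (2 * Real.pi))⁻¹ * ∫ u in s..t, gaussKernel u := by
  rw [stdGaussTail_eq, stdGaussTail_eq, ← mul_sub,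
    intervalIntegral.integral_Ioi_sub_Ioi integrable_gaussKernel.integrableOn hst]

lemma abs_stdGaussTail_sub_le {s t C : ℝ} (hst : s ≤ t)
    (hC : ∀ u ∈ Set.Icc s t, gaussKernel u ≤ C) :
    |stdGaussTail s - stdGaussTail t| ≤ (t - s) * C := by
  have hC0 : 0 ≤ C := (gaussKernel_pos s).le.trans (hC s ⟨le_rfl, hst⟩)
  have h := intervalIntegral.norm_integral_le_of_norm_le_const (a := s) (b := t)
    (f := gaussKernel) (C := C) fun u hu => by
      rw [Set.uIoc_of_le hst] at hu
      rw [Real.norm_of_nonneg (gaussKernel_pos u).le]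
      exact hC u ⟨hu.1.le, hu.2⟩
  rw [Real.norm_eq_abs, abs_of_nonneg (sub_nonneg.2 hst)] at h
  rw [stdGaussTail_sub_eq hst, abs_mul, abs_of_nonneg (by positivity)]
  calc _ ≤ 1 * |∫ u in s..t, gaussKernel u| :=
        mul_le_mul_of_nonneg_right sqrt_two_pi_inv_le_one (abs_nonneg _)
    _ ≤ _ := by linarith

/-- The total variation of the Gaussian kernel on `[s, ∞)`. -/
noncomputable def gaussVariation (s : ℝ) : ℝ :=
  if 0 ≤ s then gaussKernel s else 2 - gaussKernel s

lemma gaussKernel_le_of_sq_le {s t : ℝ} (h : s ^ 2 ≤ t ^ 2) : gaussKernel t ≤ gaussKernel s :=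
  Real.exp_le_exp.2 (by linarith)

lemma abs_gaussKernel_sub_le {s t : ℝ} (hst : s ≤ t) :
    |gaussKernel s - gaussKernel t| ≤ gaussVariation s - gaussVariation t := by
  unfold gaussVariation
  have hs1 := gaussKernel_le_one s
  have ht1 := gaussKernel_le_one t
  split_ifs with hs ht ht
  · have := gaussKernel_le_of_sq_le (pow_le_pow_left₀ hs hst 2)
    rw [abs_of_nonneg (by linarith)]
  · linarith
  · rw [abs_le]
    constructor <;> linarith
  · have : gaussKernel s ≤ gaussKernel t := gaussKernel_le_of_sq_le (by nlinarith)
    rw [abs_of_nonpos (by linarith)]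
    linarith

lemma gaussVariation_anti {s t : ℝ} (hst : s ≤ t) : gaussVariation t ≤ gaussVariation s := by
  linarith [abs_gaussKernel_sub_le hst, abs_nonneg (gaussKernel s - gaussKernel t)]

lemma gaussVariation_nonneg (s : ℝ) : 0 ≤ gaussVariation s := by
  unfold gaussVariation
  split_ifs <;> linarith [gaussKernel_pos s, gaussKernel_le_one s]

lemma gaussVariation_le_two (s : ℝ) : gaussVariation s ≤ 2 := by
  unfold gaussVariation
  split_ifs <;> linarith [gaussKernel_pos s, gaussKernel_le_one s]

lemma abs_riemann_step_sub_le {s h : ℝ} (hh : 0 ≤ h) :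
    |h * (Real.sqrt (2 * Real.pi))⁻¹ * gaussKernel s - (stdGaussTail s - stdGaussTail (s + h))| ≤
      h * (gaussVariation s - gaussVariation (s + h)) := by
  have hst : s ≤ s + h := by linarith
  have hint : ∫ u in s..(s + h), (gaussKernel s - gaussKernel u) =
      h * gaussKernel s - ∫ u in s..(s + h), gaussKernel u := by
    rw [intervalIntegral.integral_sub (by simp)
      (continuous_gaussKernel.intervalIntegrable _ _)]
    simp
  have hb := intervalIntegral.norm_integral_le_of_norm_le_const (a := s) (b := s + h)
    (f := fun u => gaussKernel s - gaussKernel u)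
    (C := gaussVariation s - gaussVariation (s + h)) fun u hu => by
      rw [Set.uIoc_of_le hst] at hu
      rw [Real.norm_eq_abs]
      linarith [abs_gaussKernel_sub_le hu.1.le, gaussVariation_anti hu.2]
  rw [hint, Real.norm_eq_abs, add_sub_cancel_left, abs_of_nonneg hh] at hb
  rw [stdGaussTail_sub_eq hst]
  calc |h * (Real.sqrt (2 * Real.pi))⁻¹ * gaussKernel s -
        (Real.sqrt (2 * Real.pi))⁻¹ * ∫ u in s..(s + h), gaussKernel u|
      = (Real.sqrt (2 * Real.pi))⁻¹ * |h * gaussKernel s - ∫ u in s..(s + h), gaussKernel u| := by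
        rw [← abs_of_nonneg (by positivity : 0 ≤ (Real.sqrt (2 * Real.pi))⁻¹), ← abs_mul,
          abs_of_nonneg (by positivity : 0 ≤ (Real.sqrt (2 * Real.pi))⁻¹)]
        ring_nf
    _ ≤ 1 * |h * gaussKernel s - ∫ u in s..(s + h), gaussKernel u| :=
        mul_le_mul_of_nonneg_right sqrt_two_pi_inv_le_one (abs_nonneg _)
    _ ≤ _ := by linarith

/-- The Gaussian weight approximating the probability of `j` heads. -/
noncomputable def gaussWeight (n : ℕ) (ε : ℝ) (j : ℕ) : ℝ :=
  2 / Real.sqrt n * (Real.sqrt (2 * Real.pi))⁻¹ * gaussKernel (headScore n ε j)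

lemma headScore_succ (n : ℕ) (ε : ℝ) (j : ℕ) :
    headScore n ε (j + 1) = headScore n ε j + 2 / Real.sqrt n := by
  unfold headScore
  push_cast
  ring

lemma gaussWeight_pos {n : ℕ} (hn : 1 ≤ n) (ε : ℝ) (j : ℕ) : 0 < gaussWeight n ε j := by
  have hn0 : (0 : ℝ) < n := by exact_mod_cast hn
  have := gaussKernel_pos (headScore n ε j)
  have := Real.pi_pos
  unfold gaussWeight
  positivity

lemma abs_sum_gaussWeight_sub_le (n : ℕ) (ε : ℝ) {p q : ℕ} (hpq : p ≤ q) :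
    |∑ j ∈ Finset.Ico p q, gaussWeight n ε j -
      (stdGaussTail (headScore n ε p) - stdGaussTail (headScore n ε q))| ≤
      2 / Real.sqrt n *
        (gaussVariation (headScore n ε p) - gaussVariation (headScore n ε q)) := by
  induction q, hpq using Nat.le_induction with
  | base => simp
  | succ q hpq ih =>
    have h := abs_riemann_step_sub_le (s := headScore n ε q) (h := 2 / Real.sqrt n) (by positivity)
    rw [← headScore_succ] at h
    rw [Finset.sum_Ico_succ_top hpq]
    have hg : gaussWeight n ε q =
      2 / Real.sqrt n * (Real.sqrt (2 * Real.pi))⁻¹ * gaussKernel (headScore n ε q) := rfl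
    rw [← hg] at h
    rw [abs_le] at *
    constructor <;> linarith [h.1, h.2, ih.1, ih.2]

/-- A per-step bound on the logarithm of the ratio `w / g` accumulates linearly. -/
lemma log_ratio_accumulate {w g : ℕ → ℝ} {η : ℝ} (hg : ∀ j, 0 < g j) {p : ℕ} (q : ℕ) (hpq : p ≤ q)
    (hstep : ∀ j, p ≤ j → j < q →
      ∃ z : ℝ, |z| ≤ η ∧ w (j + 1) * g j = Real.exp z * (w j * g (j + 1))) :
    ∃ z : ℝ, |z| ≤ (q - p) * η ∧ w q * g p = Real.exp z * (w p * g q) := by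
  induction q, hpq using Nat.le_induction with
  | base => exact ⟨0, by simp, by simp⟩
  | succ q hpq ih =>
    obtain ⟨z, hz, hzq⟩ := ih fun j h1 h2 => hstep j h1 (by omega)
    obtain ⟨y, hy, hyq⟩ := hstep q hpq (by omega)
    refine ⟨y + z, (abs_add_le y z).trans ?_, ?_⟩
    · push_cast
      linarith
    · refine mul_right_cancel₀ (hg q).ne' ?_
      rw [Real.exp_add]
      linear_combination g p * hyq + Real.exp y * g (q + 1) * hzq

lemma cross_ratio_le {w g : ℕ → ℝ} {η δ : ℝ} {m M : ℕ} (hw : ∀ j, 0 ≤ w j) (hg : ∀ j, 0 < g j)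
    (hη : 0 ≤ η)
    (hstep : ∀ j, m ≤ j → j + 1 < M →
      ∃ z : ℝ, |z| ≤ η ∧ w (j + 1) * g j = Real.exp z * (w j * g (j + 1)))
    (hδ : ((M : ℝ) - 1 - m) * η ≤ δ) {i j : ℕ} (hi : i ∈ Finset.Ico m M)
    (hj : j ∈ Finset.Ico m M) : w i * g j ≤ Real.exp δ * (g i * w j) := by
  rw [Finset.mem_Ico] at hi hj
  have key : ∀ p q : ℕ, m ≤ p → q < M → p ≤ q →
      ∃ z : ℝ, |z| ≤ δ ∧ w q * g p = Real.exp z * (w p * g q) := fun p q hp hq hpq => by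
    obtain ⟨z, hz, hzq⟩ := log_ratio_accumulate hg q hpq fun j h1 h2 =>
      hstep j (by omega) (by omega)
    refine ⟨z, hz.trans (le_trans ?_ hδ), hzq⟩
    have h1 : (m : ℝ) ≤ p := by exact_mod_cast hp
    have h2 : (q : ℝ) + 1 ≤ M := by exact_mod_cast hq
    exact mul_le_mul_of_nonneg_right (by linarith) hη
  rcases le_total i j with hij | hij
  · obtain ⟨z, hz, hzq⟩ := key i j hi.1 hj.2 hij
    have h : w i * g j = Real.exp (-z) * (g i * w j) := by
      rw [mul_comm (g i), hzq, ← mul_assoc, ← Real.exp_add]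
      simp
    rw [h]
    exact mul_le_mul_of_nonneg_right (Real.exp_le_exp.2 (by linarith [(abs_le.1 hz).1]))
      (mul_nonneg (hg i).le (hw j))
  · obtain ⟨z, hz, hzq⟩ := key j i hj.1 hi.2 hij
    rw [hzq, mul_comm (w j)]
    exact mul_le_mul_of_nonneg_right (Real.exp_le_exp.2 (abs_le.1 hz).2)
      (mul_nonneg (hg i).le (hw j))

lemma sum_mul_sum_le_of_cross_ratio {w g : ℕ → ℝ} {E : ℝ} {A B : Finset ℕ}
    (h : ∀ i ∈ A, ∀ j ∈ B, w i * g j ≤ E * (g i * w j)) :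
    (∑ i ∈ A, w i) * ∑ j ∈ B, g j ≤ E * ((∑ i ∈ A, g i) * ∑ j ∈ B, w j) := by
  rw [Finset.sum_mul_sum, Finset.sum_mul_sum, Finset.mul_sum]
  refine Finset.sum_le_sum fun i hi => ?_
  rw [Finset.mul_sum]
  exact Finset.sum_le_sum fun j hj => h i hi j hj

lemma abs_div_add_sub_div_add_le {U L P Q E : ℝ} (hU : 0 ≤ U) (hL : 0 ≤ L) (hP : 0 ≤ P) (hE : 1 ≤ E)
    (h1 : U * Q ≤ E * (P * L)) (h2 : L * P ≤ E * (Q * U)) (hUL : 0 < U + L) (hPQ : 0 < P + Q) :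
    |U / (U + L) - P / (P + Q)| ≤ (E - 1) * (P / (P + Q)) := by
  have hnum : |U * Q - P * L| ≤ (E - 1) * (P * L) := by
    rw [abs_le]
    constructor
    · rcases le_total (U * Q) (P * L) with h | h
      · nlinarith
      · have := mul_nonneg (by linarith : 0 ≤ E - 1) (mul_nonneg hP hL)
        linarith
    · linarith
  have hdiff : U / (U + L) - P / (P + Q) = (U * Q - P * L) / ((U + L) * (P + Q)) := by
    field_simp
    ring
  rw [hdiff, abs_div, abs_of_pos (mul_pos hUL hPQ), div_le_iff₀ (mul_pos hUL hPQ)]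
  calc |U * Q - P * L| ≤ (E - 1) * (P * L) := hnum
    _ ≤ (E - 1) * (P * (U + L)) :=
        mul_le_mul_of_nonneg_left (mul_le_mul_of_nonneg_left (by linarith) hP) (by linarith)
    _ = (E - 1) * (P / (P + Q)) * ((U + L) * (P + Q)) := by field_simp

/-- If `(P, Q)` is close to a probability vector `(A, B)`, and `(U, L)` is proportional to `(P, Q)`
up to a factor `E`, then the first normalised component of `(U, L)` is close to `A`. -/
lemma abs_normalized_sub_le {U L P Q A B E e₁ e₂ : ℝ} (hU : 0 ≤ U) (hL : 0 ≤ L) (hP : 0 ≤ P)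
    (hQ : 0 ≤ Q) (hE : 1 ≤ E) (h1 : U * Q ≤ E * (P * L)) (h2 : L * P ≤ E * (Q * U))
    (hUL : 0 < U + L) (hA : 0 ≤ A) (hB : 0 ≤ B) (hAB : A + B = 1)
    (he1 : |P - A| ≤ e₁) (he2 : |Q - B| ≤ e₂) (he : e₁ + e₂ ≤ 1 / 2) :
    |U / (U + L) - A| ≤ (E - 1) * (2 * (A + e₁)) + 2 * (e₁ + e₂ * A) := by
  have hp1 := abs_le.1 he1
  have hp2 := abs_le.1 he2
  have hPQ : 1 / 2 ≤ P + Q := by linarith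
  have hPQ0 : 0 < P + Q := by linarith
  have hfirst := abs_div_add_sub_div_add_le hU hL hP hE h1 h2 hUL hPQ0
  have hle : P / (P + Q) ≤ 2 * (A + e₁) := by
    rw [div_le_iff₀ hPQ0]
    nlinarith
  have hsecond : |P / (P + Q) - A| ≤ 2 * (e₁ + e₂ * A) := by
    have : P / (P + Q) - A = ((P - A) * B - (Q - B) * A) / (P + Q) := by
      have hB' : B = 1 - A := by linarith
      rw [hB']
      field_simp
      ring
    rw [this, abs_div, abs_of_pos hPQ0, div_le_iff₀ hPQ0]
    have hnum : |(P - A) * B - (Q - B) * A| ≤ e₁ + e₂ * A := by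
      refine (abs_sub _ _).trans ?_
      rw [abs_mul, abs_mul, abs_of_nonneg hA, abs_of_nonneg hB]
      have := abs_nonneg (P - A)
      nlinarith [mul_le_mul_of_nonneg_right he2 hA]
    have h0 : 0 ≤ e₁ + e₂ * A := (abs_nonneg _).trans hnum
    nlinarith
  calc |U / (U + L) - A| ≤ |U / (U + L) - P / (P + Q)| + |P / (P + Q) - A| := abs_sub_le _ _ _
    _ ≤ (E - 1) * (P / (P + Q)) + 2 * (e₁ + e₂ * A) := add_le_add hfirst hsecond
    _ ≤ _ := by
      have := mul_le_mul_of_nonneg_left hle (by linarith : 0 ≤ E - 1)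
      linarith

lemma gaussKernel_neg (s : ℝ) : gaussKernel (-s) = gaussKernel s := by simp [gaussKernel]

lemma normalized_error_le {A E f h δ τ : ℝ} (hA : 0 ≤ A) (hAf : A ≤ f) (hf1 : f ≤ 1) (hh0 : 0 ≤ h)
    (hh : h ≤ 1 / 10) (hτ : 0 ≤ τ) (hδ : 0 ≤ δ) (hE : E - 1 ≤ 2 * δ) :
    (E - 1) * (2 * (A + (h * f + τ))) + 2 * ((h * f + τ) + (h * 2 + τ) * A) ≤
      4 * δ * (2 * f + τ) + 6 * h * f + 4 * τ := by
  have hf0 : 0 ≤ f := hA.trans hAf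
  have e1 : A + (h * f + τ) ≤ 2 * f + τ := by nlinarith
  have e2 : (E - 1) * (2 * (A + (h * f + τ))) ≤ 2 * δ * (2 * (2 * f + τ)) :=
    mul_le_mul hE (by linarith) (by positivity) (by linarith)
  have e3 : (h * 2 + τ) * A ≤ h * 2 * f + τ := by nlinarith
  linarith

/-- Comparison of the binomial and Gaussian tails at the lattice point `j₀`, in terms of bounds on
the mass outside the window `[m, M)` and of a per-step bound on the ratio inside it. -/
lemma abs_sum_headPMF_sub_stdGaussTail_le {n j₀ m M : ℕ} {ε η δ τ : ℝ} (hn : 1 ≤ n)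
    (hε : ε ∈ Set.Icc (-1 : ℝ) 1) (hm : m ≤ j₀) (hM : j₀ ≤ M) (hMn : M ≤ n + 1) (hη : 0 ≤ η)
    (hstep : ∀ j, m ≤ j → j + 1 < M → ∃ z : ℝ, |z| ≤ η ∧
      headPMF n ε (j + 1) * gaussWeight n ε j =
        Real.exp z * (headPMF n ε j * gaussWeight n ε (j + 1)))
    (hδ : ((M : ℝ) - 1 - m) * η ≤ δ) (hδ0 : 0 ≤ δ) (hδ1 : δ ≤ 1)
    (hlower : ∑ j ∈ Finset.Ico 0 m, headPMF n ε j ≤ τ)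
    (hupper : ∑ j ∈ Finset.Ico M (n + 1), headPMF n ε j ≤ τ)
    (hglower : stdGaussTail (-headScore n ε m) ≤ τ)
    (hgupper : stdGaussTail (headScore n ε M) ≤ τ)
    (hτ : τ ≤ 1 / Real.sqrt n) (hh : 2 / Real.sqrt n ≤ 1 / 10) :
    |∑ j ∈ Finset.Ico j₀ (n + 1), headPMF n ε j - stdGaussTail (headScore n ε j₀)| ≤
      4 * δ * (2 * gaussKernel (headScore n ε j₀) + τ) +
        (12 / Real.sqrt n) * gaussKernel (headScore n ε j₀) + 7 * τ := by
  have hτ0 : 0 ≤ τ := (stdGaussTail_nonneg _).trans hgupper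
  have hh' : 1 / Real.sqrt n = 2 / Real.sqrt n / 2 := by ring
  have h12 : 12 / Real.sqrt n = 6 * (2 / Real.sqrt n) := by ring
  have hh0 : 0 ≤ 2 / Real.sqrt n := by positivity
  have habsU := abs_le.1 (abs_sum_gaussWeight_sub_le n ε hM)
  have habsL := abs_le.1 (abs_sum_gaussWeight_sub_le n ε hm)
  rw [hh'] at hτ
  rw [h12]
  set h := 2 / Real.sqrt n
  set s := headScore n ε j₀
  set f := gaussKernel s
  set Uw := ∑ j ∈ Finset.Ico j₀ M, headPMF n ε j with hUw
  set Lw := ∑ j ∈ Finset.Ico m j₀, headPMF n ε j with hLw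
  set Ug := ∑ j ∈ Finset.Ico j₀ M, gaussWeight n ε j with hUg
  set Lg := ∑ j ∈ Finset.Ico m j₀, gaussWeight n ε j with hLg
  have hf0 : 0 < f := gaussKernel_pos s
  have hf1 : f ≤ 1 := gaussKernel_le_one s
  have hw := headPMF_nonneg (n := n) hε
  have hg := gaussWeight_pos hn ε
  have hUw0 : 0 ≤ Uw := Finset.sum_nonneg fun j _ => hw j
  have hLw0 : 0 ≤ Lw := Finset.sum_nonneg fun j _ => hw j
  have hUg0 : 0 ≤ Ug := Finset.sum_nonneg fun j _ => (hg j).le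
  have hLg0 : 0 ≤ Lg := Finset.sum_nonneg fun j _ => (hg j).le
  have hsubU : Finset.Ico j₀ M ⊆ Finset.Ico m M := Finset.Ico_subset_Ico_left hm
  have hsubL : Finset.Ico m j₀ ⊆ Finset.Ico m M := Finset.Ico_subset_Ico_right hM
  have hcross : ∀ i ∈ Finset.Ico m M, ∀ j ∈ Finset.Ico m M,
      headPMF n ε i * gaussWeight n ε j ≤ Real.exp δ * (gaussWeight n ε i * headPMF n ε j) :=
    fun i hi j hj => cross_ratio_le hw hg hη hstep hδ hi hj
  have hUL : Uw * Lg ≤ Real.exp δ * (Ug * Lw) := sum_mul_sum_le_of_cross_ratio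
    fun i hi j hj => hcross i (hsubU hi) j (hsubL hj)
  have hLU : Lw * Ug ≤ Real.exp δ * (Lg * Uw) := sum_mul_sum_le_of_cross_ratio
    fun i hi j hj => hcross i (hsubL hi) j (hsubU hj)
  have hE1 : 1 ≤ Real.exp δ := Real.one_le_exp hδ0
  have hE2 : Real.exp δ - 1 ≤ 2 * δ := by
    have := (abs_le.1 (Real.abs_exp_sub_one_le (x := δ) (by rwa [abs_of_nonneg hδ0]))).2
    rwa [abs_of_nonneg hδ0] at this
  have hsplitU : ∑ j ∈ Finset.Ico j₀ (n + 1), headPMF n ε j =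
      Uw + ∑ j ∈ Finset.Ico M (n + 1), headPMF n ε j :=
    (Finset.sum_Ico_consecutive _ hM hMn).symm
  have htotal : ∑ j ∈ Finset.Ico 0 m, headPMF n ε j +
      (Lw + (Uw + ∑ j ∈ Finset.Ico M (n + 1), headPMF n ε j)) = 1 := by
    rw [← hsplitU, Finset.sum_Ico_consecutive _ hm (hM.trans hMn),
      Finset.sum_Ico_consecutive _ (Nat.zero_le m) ((hm.trans hM).trans hMn),
      Nat.Ico_zero_eq_range, sum_headPMF]
  have hlower0 : 0 ≤ ∑ j ∈ Finset.Ico 0 m, headPMF n ε j := Finset.sum_nonneg fun j _ => hw j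
  have hupper0 : 0 ≤ ∑ j ∈ Finset.Ico M (n + 1), headPMF n ε j :=
    Finset.sum_nonneg fun j _ => hw j
  have hS : 0 < Uw + Lw := by linarith
  have hA0 := stdGaussTail_nonneg s
  have hB0 := stdGaussTail_nonneg (-s)
  have hAB := stdGaussTail_add_neg s
  have heU : |Ug - stdGaussTail s| ≤ h * gaussVariation s + τ := by
    have := mul_nonneg hh0 (gaussVariation_nonneg (headScore n ε M))
    have := stdGaussTail_nonneg (headScore n ε M)
    rw [abs_le]
    constructor <;> linarith [habsU.1, habsU.2]
  have heL : |Lg - stdGaussTail (-s)| ≤ h * (2 - gaussVariation s) + τ := by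
    have := mul_le_mul_of_nonneg_left (gaussVariation_le_two (headScore n ε m)) hh0
    have := stdGaussTail_nonneg (-headScore n ε m)
    have := stdGaussTail_add_neg (headScore n ε m)
    rw [abs_le]
    constructor <;> linarith [habsL.1, habsL.2]
  have hwindow : |Uw / (Uw + Lw) - stdGaussTail s| ≤
      4 * δ * (2 * f + τ) + 6 * h * f + 4 * τ := by
    have herr : h * f + τ + (h * 2 + τ) ≤ 1 / 2 := by
      linarith [mul_le_mul_of_nonneg_left hf1 hh0]
    rcases le_or_gt 0 s with hs | hs
    · have hv : gaussVariation s = f := if_pos hs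
      rw [hv] at heU heL
      have heL' : |Lg - stdGaussTail (-s)| ≤ h * 2 + τ :=
        heL.trans (by linarith [mul_nonneg hh0 hf0.le])
      refine (abs_normalized_sub_le hUw0 hLw0 hUg0 hLg0 hE1 hUL hLU hS hA0 hB0 hAB heU heL'
        herr).trans (normalized_error_le hA0 (stdGaussTail_le hs)
          hf1 hh0 hh hτ0 hδ0 hE2)
    · have hv : gaussVariation s = 2 - f := if_neg (not_le.2 hs)
      rw [hv] at heU heL
      have heU' : |Ug - stdGaussTail s| ≤ h * 2 + τ :=
        heU.trans (by linarith [mul_nonneg hh0 hf0.le])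
      rw [sub_sub_cancel] at heL
      have hBf : stdGaussTail (-s) ≤ f :=
        (stdGaussTail_le (by linarith)).trans_eq (gaussKernel_neg s)
      have hflip : Uw / (Uw + Lw) - stdGaussTail s =
          -(Lw / (Lw + Uw) - stdGaussTail (-s)) := by
        have : Lw / (Lw + Uw) = 1 - Uw / (Uw + Lw) := by
          rw [add_comm Lw Uw]
          field_simp
          ring
        linarith
      rw [hflip, abs_neg]
      refine (abs_normalized_sub_le hLw0 hUw0 hLg0 hUg0 hE1 hLU hUL (by linarith) hB0 hA0
        (by linarith) heL heU' herr).trans (normalized_error_le hB0 hBf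
          hf1 hh0 hh hτ0 hδ0 hE2)
  have hquot : |Uw - Uw / (Uw + Lw)| ≤ 2 * τ := by
    have hle : Uw / (Uw + Lw) ≤ 1 := (div_le_one hS).2 (by linarith)
    have h0 : 0 ≤ Uw / (Uw + Lw) := div_nonneg hUw0 hS.le
    have heq : Uw - Uw / (Uw + Lw) = -(Uw / (Uw + Lw) * (1 - (Uw + Lw))) := by
      field_simp
      ring
    rw [heq, abs_neg, abs_of_nonneg (mul_nonneg h0 (by linarith))]
    have := mul_le_mul_of_nonneg_right hle (by linarith : 0 ≤ 1 - (Uw + Lw))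
    linarith
  have hquot' := abs_le.1 hquot
  have hwindow' := abs_le.1 hwindow
  rw [hsplitU, abs_le]
  constructor <;> linarith only [hquot'.1, hquot'.2, hwindow'.1, hwindow'.2, hupper, hupper0]

lemma gaussKernel_le_three_mul {x y : ℝ} (h : x ^ 2 - y ^ 2 ≤ 2) :
    gaussKernel y ≤ 3 * gaussKernel x := by
  have h1 : gaussKernel y ≤ Real.exp 1 * gaussKernel x := by
    unfold gaussKernel
    rw [← Real.exp_add]
    exact Real.exp_le_exp.2 (by linarith)
  have h2 : Real.exp 1 ≤ 3 := Real.exp_one_lt_three.le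
  exact h1.trans (mul_le_mul_of_nonneg_right h2 (gaussKernel_pos x).le)

set_option maxHeartbeats 1000000 in
/-- The binomial-Gaussian comparison at scale `r`, which is `√(log n / n)` in the application. -/
lemma abs_binTail_sub_stdGaussTail_le {n : ℕ} {k : ℤ} {ε a b r : ℝ} (hn : 1 ≤ n) (hb : 0 < b)
    (ha : a = 2 * b ^ 2 + b + 3) (hr : 0 < r) (hε : ε ∈ Set.Icc (-1 : ℝ) 1) (hεr : |ε| ≤ b * r)
    (hk : |(k : ℝ)| ≤ b * n * r) (har : a * r ≤ 1 / 2) (hnr : 2 ≤ n * r)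
    (hδ1 : 8 * a ^ 3 * (n * r ^ 3) ≤ 1) (hh : 2 / Real.sqrt n ≤ 1 / 10)
    (hexp : Real.exp (-(n * r ^ 2)) ≤ 1 / Real.sqrt n) (hsn : 1 / Real.sqrt n ≤ n * r ^ 3) :
    |binTail n ε k - stdGaussTail (((k : ℝ) - ε * n) / Real.sqrt n)| ≤
      (224 * a ^ 3 + 46) * (n * r ^ 3) * gaussKernel (((k : ℝ) - ε * n) / Real.sqrt n) := by
  have hn0 : (0 : ℝ) < n := by exact_mod_cast hn
  have hsq : 0 < Real.sqrt n := Real.sqrt_pos.2 hn0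
  have hsq2 : Real.sqrt n ^ 2 = n := Real.sq_sqrt hn0.le
  have hba : b ≤ a := by rw [ha]; nlinarith
  have ha3 : 3 ≤ a := by rw [ha]; nlinarith
  have hbr : b * r ≤ 1 / 2 := (mul_le_mul_of_nonneg_right hba hr.le).trans har
  have hr6 : r ≤ 1 / 6 := by nlinarith
  have hN : 0 ≤ n * r ^ 2 := by positivity
  have hk' := abs_le.1 hk
  have hε' := abs_le.1 hεr
  have harn : a * n * r ≤ n / 2 := by nlinarith
  have hbrn : b * n * r ≤ n / 2 := by nlinarith
  have hbarn : b * n * r ≤ a * n * r := by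
    have := mul_le_mul_of_nonneg_right hba (by positivity : 0 ≤ n * r)
    linarith
  have hεn : |ε * n| ≤ b * n * r := by
    rw [abs_mul, abs_of_pos hn0]
    nlinarith
  have hεn' := abs_le.1 hεn
  set x := ((k : ℝ) - ε * n) / Real.sqrt n with hx
  have hxsq : x * Real.sqrt n = k - ε * n := by rw [hx]; field_simp
  have hxabs : |x| ≤ 2 * b * r * Real.sqrt n := by
    rw [hx, abs_div, abs_of_pos hsq, div_le_iff₀ hsq]
    calc |(k : ℝ) - ε * n| ≤ |(k : ℝ)| + |ε * n| := abs_sub _ _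
      _ ≤ 2 * b * r * (Real.sqrt n ^ 2) := by rw [hsq2]; linarith
      _ = _ := by ring
  set F := gaussKernel x with hF
  have hF0 : 0 < F := gaussKernel_pos x
  have hF1 : F ≤ 1 := gaussKernel_le_one x
  have hFlow : Real.exp (-(2 * b ^ 2 * (n * r ^ 2))) ≤ F := by
    have : x ^ 2 ≤ (2 * b * r * Real.sqrt n) ^ 2 := sq_le_sq' (by linarith [(abs_le.1 hxabs).1])
      (abs_le.1 hxabs).2
    rw [mul_pow, hsq2] at this
    exact Real.exp_le_exp.2 (by linarith)
  have hτ : ∀ z, z ≤ -((2 * b ^ 2 + 1) * (n * r ^ 2)) → Real.exp z ≤ F * (1 / Real.sqrt n) :=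
    fun z hz => by
      calc Real.exp z ≤ Real.exp (-(2 * b ^ 2 * (n * r ^ 2)) + -(n * r ^ 2)) :=
            Real.exp_le_exp.2 (by linarith)
        _ = Real.exp (-(2 * b ^ 2 * (n * r ^ 2))) * Real.exp (-(n * r ^ 2)) := Real.exp_add _ _
        _ ≤ _ := mul_le_mul hFlow hexp (Real.exp_pos _).le hF0.le
  have hgτ : ∀ y : ℝ, (2 * b ^ 2 + 2) * (n * r) ≤ y →
      stdGaussTail (y / Real.sqrt n) ≤ F * (1 / Real.sqrt n) := fun y hy => by
    have h0 : 0 ≤ (2 * b ^ 2 + 2) * (n * r) := by positivity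
    refine (stdGaussTail_le (div_nonneg (h0.trans hy) hsq.le)).trans (hτ _ ?_)
    rw [div_pow, hsq2]
    have h1 : ((2 * b ^ 2 + 2) * (n * r)) ^ 2 / n ≤ y ^ 2 / n :=
      div_le_div_of_nonneg_right (pow_le_pow_left₀ h0 hy 2) hn0.le
    have h2 : ((2 * b ^ 2 + 2) * (n * r)) ^ 2 / n = (2 * b ^ 2 + 2) ^ 2 * (n * r ^ 2) := by
      field_simp
    rw [h2] at h1
    linarith [mul_nonneg hN (sq_nonneg b), mul_nonneg hN (sq_nonneg (b ^ 2))]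
  have hkn : -(n : ℤ) ≤ k := by
    have : (-(n : ℝ)) ≤ k := by linarith
    exact_mod_cast this
  rw [binTail_eq_sum_headPMF n ε k hkn]
  set j₀ := ((n + k + 1) / 2).toNat with hj₀
  have hj1 : (n : ℝ) + k ≤ 2 * j₀ := by
    have : (n : ℤ) + k ≤ 2 * (j₀ : ℤ) := by omega
    exact_mod_cast this
  have hj2 : 2 * (j₀ : ℝ) ≤ n + k + 1 := by
    have : 2 * (j₀ : ℤ) ≤ n + k + 1 := by omega
    exact_mod_cast this
  set m := ⌈((n : ℝ) - a * n * r) / 2⌉₊ with hm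
  set M := ⌊((n : ℝ) + a * n * r) / 2⌋₊ + 1 with hM
  have hfl : 0 ≤ ((n : ℝ) + a * n * r) / 2 := by positivity
  have hm1 : (n : ℝ) - a * n * r ≤ 2 * m := by
    linarith [Nat.le_ceil (((n : ℝ) - a * n * r) / 2)]
  have hm2 : 2 * (m : ℝ) ≤ n - a * n * r + 2 := by
    linarith [(Nat.ceil_lt_add_one (by linarith : 0 ≤ ((n : ℝ) - a * n * r) / 2)).le]
  have hMlt : (n : ℝ) + a * n * r ≤ 2 * M := by
    have := (Nat.lt_floor_add_one (((n : ℝ) + a * n * r) / 2)).le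
    rw [hM]; push_cast; linarith
  have hMle : 2 * ((M : ℝ) - 1) ≤ n + a * n * r := by
    have := Nat.floor_le hfl
    rw [hM]; push_cast; linarith
  have hj1' : m ≤ j₀ := Nat.ceil_le.2 (by linarith)
  have hj2' : j₀ ≤ M := by
    have : (j₀ : ℝ) < M + 1 := by linarith
    exact Nat.lt_succ_iff.1 (by exact_mod_cast this)
  have hMn : M ≤ n + 1 := by
    have : (M : ℝ) < n + 1 + 1 := by linarith
    exact Nat.lt_succ_iff.1 (by exact_mod_cast this)
  have hlower : ∑ j ∈ Finset.Ico 0 m, headPMF n ε j ≤ F * (1 / Real.sqrt n) := by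
    refine (sum_headPMF_le_exp (s := -r) (R := r * (a * n * r)) hε
      (by rw [abs_neg, abs_of_pos hr]; linarith) ?_ fun j hj => ?_).trans (hτ _ ?_)
    · rw [← Nat.Ico_zero_eq_range]
      exact Finset.Ico_subset_Ico_right (by omega)
    · have hjm : j < m := (Finset.mem_Ico.1 hj).2
      have := Nat.lt_ceil.1 hjm
      have := mul_le_mul_of_nonneg_left (by linarith : a * n * r ≤ n - 2 * j) hr.le
      linarith
    · have := mul_le_mul_of_nonneg_left hεn'.1 hr.le
      rw [ha]
      linarith
  have hupper : ∑ j ∈ Finset.Ico M (n + 1), headPMF n ε j ≤ F * (1 / Real.sqrt n) := by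
    refine (sum_headPMF_le_exp (s := r) (R := r * (a * n * r)) hε
      (by rw [abs_of_pos hr]; linarith) ?_ fun j hj => ?_).trans (hτ _ ?_)
    · rw [← Nat.Ico_zero_eq_range]
      exact Finset.Ico_subset_Ico_left (Nat.zero_le M)
    · have hMj : (M : ℝ) ≤ j := by exact_mod_cast (Finset.mem_Ico.1 hj).1
      exact mul_le_mul_of_nonneg_left (by linarith) hr.le
    · have := mul_le_mul_of_nonneg_left hεn'.2 hr.le
      rw [ha]
      linarith
  have hglower : stdGaussTail (-headScore n ε m) ≤ F * (1 / Real.sqrt n) := by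
    unfold headScore
    rw [← neg_div]
    refine hgτ _ ?_
    rw [ha] at hm2
    linarith
  have hgupper : stdGaussTail (headScore n ε M) ≤ F * (1 / Real.sqrt n) := by
    refine hgτ _ ?_
    rw [ha] at hMlt
    linarith
  have hstep : ∀ j, m ≤ j → j + 1 < M → ∃ z : ℝ, |z| ≤ 8 * (a * r) ^ 2 ∧
      headPMF n ε (j + 1) * gaussWeight n ε j =
        Real.exp z * (headPMF n ε j * gaussWeight n ε (j + 1)) := fun j hmj hjM => by
    have h1 : (m : ℝ) ≤ j := by exact_mod_cast hmj
    have h2 : (j : ℝ) + 1 + 1 ≤ M := by exact_mod_cast hjM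
    obtain ⟨z, hz, hzj⟩ := headPMF_succ_log_ratio (j := j) hn har
      (hεr.trans (mul_le_mul_of_nonneg_right hba hr.le))
      (by rw [abs_le]; constructor <;> linarith) (by rw [abs_le]; constructor <;> linarith)
    refine ⟨z, hz, ?_⟩
    unfold gaussWeight
    linear_combination (2 / Real.sqrt n * (Real.sqrt (2 * Real.pi))⁻¹) * hzj
  have hδ : ((M : ℝ) - 1 - m) * (8 * (a * r) ^ 2) ≤ 8 * a ^ 3 * (n * r ^ 3) := by
    calc ((M : ℝ) - 1 - m) * (8 * (a * r) ^ 2) ≤ (a * n * r) * (8 * (a * r) ^ 2) :=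
          mul_le_mul_of_nonneg_right (by linarith) (by positivity)
      _ = _ := by ring
  have hτle : F * (1 / Real.sqrt n) ≤ 1 / Real.sqrt n :=
    mul_le_of_le_one_left (by positivity) hF1
  have hmain := abs_sum_headPMF_sub_stdGaussTail_le hn hε hj1' hj2' hMn (by positivity) hstep hδ
    (by positivity) hδ1 hlower hupper hglower hgupper hτle hh
  set s := headScore n ε j₀ with hs
  have hxs : x ≤ s := div_le_div_of_nonneg_right (by linarith) hsq.le
  have hsx : s - x ≤ 1 / Real.sqrt n := by
    rw [hs, headScore, hx, ← sub_div]
    exact div_le_div_of_nonneg_right (by linarith) hsq.le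
  have hker : ∀ u ∈ Set.Icc x s, gaussKernel u ≤ 3 * F := fun u hu => by
    refine gaussKernel_le_three_mul ?_
    have h0 : 0 ≤ u - x := by linarith [hu.1]
    have h1 : u - x ≤ 1 / Real.sqrt n := by linarith [hu.2]
    have h2 : (u - x) * |x| ≤ 1 / Real.sqrt n * (2 * b * r * Real.sqrt n) :=
      mul_le_mul h1 hxabs (abs_nonneg x) (by positivity)
    have h3 : 1 / Real.sqrt n * (2 * b * r * Real.sqrt n) = 2 * (b * r) := by field_simp
    have h4 : (u - x) * -|x| ≤ (u - x) * x := mul_le_mul_of_nonneg_left (neg_abs_le x) h0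
    linarith [sq_nonneg (u - x)]
  have hshift := abs_stdGaussTail_sub_le hxs hker
  have hfs := hker s ⟨hxs, le_rfl⟩
  have hD0 : 0 ≤ n * r ^ 3 := by positivity
  have hsn1 : 1 / Real.sqrt n ≤ 1 := by
    have : 2 / Real.sqrt n = 2 * (1 / Real.sqrt n) := by ring
    linarith
  have hFs : F * (1 / Real.sqrt n) ≤ F * (n * r ^ 3) := mul_le_mul_of_nonneg_left hsn hF0.le
  have hFs1 : F * (1 / Real.sqrt n) ≤ F := mul_le_of_le_one_right hF0.le hsn1
  have b1 : 4 * (8 * a ^ 3 * (n * r ^ 3)) * (2 * gaussKernel s + F * (1 / Real.sqrt n)) ≤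
      4 * (8 * a ^ 3 * (n * r ^ 3)) * (7 * F) :=
    mul_le_mul_of_nonneg_left (by linarith) (by positivity)
  have b2 : 12 / Real.sqrt n * gaussKernel s ≤ 12 / Real.sqrt n * (3 * F) :=
    mul_le_mul_of_nonneg_left hfs (by positivity)
  have b3 : 12 / Real.sqrt n * (3 * F) = 36 * (F * (1 / Real.sqrt n)) := by ring
  have b4 : (s - x) * (3 * F) ≤ 1 / Real.sqrt n * (3 * F) :=
    mul_le_mul_of_nonneg_right hsx (by positivity)
  have htri := abs_sub_le (∑ j ∈ Finset.Ico j₀ (n + 1), headPMF n ε j) (stdGaussTail s)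
    (stdGaussTail x)
  rw [abs_sub_comm (stdGaussTail s)] at htri
  linarith

lemma binTail_mem_Icc {n : ℕ} {ε : ℝ} (hε : ε ∈ Set.Icc (-1 : ℝ) 1) (k : ℤ) :
    binTail n ε k ∈ Set.Icc (0 : ℝ) 1 := by
  have hmax : binTail n ε k = binTail n ε (max k (-n)) := by
    refine (Finset.sum_subset (Finset.Icc_subset_Icc_left (le_max_left _ _)) fun t ht ht' => ?_).symm
    simp only [Finset.mem_Icc, max_le_iff] at ht ht'
    exact if_neg (by omega)
  rw [hmax, binTail_eq_sum_headPMF n ε _ (le_max_right _ _)]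
  refine ⟨Finset.sum_nonneg fun j _ => headPMF_nonneg hε j, ?_⟩
  rw [← sum_headPMF n ε, ← Nat.Ico_zero_eq_range]
  exact Finset.sum_le_sum_of_subset_of_nonneg (Finset.Ico_subset_Ico_left (Nat.zero_le _))
    fun j _ _ => headPMF_nonneg hε j

lemma stdGaussTail_le_one (x : ℝ) : stdGaussTail x ≤ 1 := by
  linarith [stdGaussTail_add_neg x, stdGaussTail_nonneg (-x)]

lemma rpow_three_halves {x : ℝ} (hx : 0 ≤ x) : x ^ ((3 : ℝ) / 2) = x * Real.sqrt x := by
  rw [show (3 : ℝ) / 2 = 1 + 1 / 2 by norm_num, Real.rpow_add_of_nonneg hx (by norm_num)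
    (by norm_num), Real.rpow_one, Real.sqrt_eq_rpow]

lemma log_le_logb_two (n : ℕ) : Real.log n ≤ Real.logb 2 n := by
  have h0 : 0 ≤ Real.log n := Real.log_natCast_nonneg n
  have h2 : 0 < Real.log 2 := Real.log_pos (by norm_num)
  have h3 : Real.log 2 ≤ 1 := by linarith [Real.log_two_lt_d9]
  unfold Real.logb
  rw [le_div_iff₀ h2]
  nlinarith

lemma eventually_log_rpow_div_sqrt_le {δ : ℝ} (hδ : 0 < δ) :
    ∀ᶠ n : ℕ in Filter.atTop, Real.log n ^ ((3 : ℝ) / 2) / Real.sqrt n ≤ δ := by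
  have h := ((isLittleO_log_rpow_rpow_atTop (3 / 2) (by norm_num : (0 : ℝ) < 1 / 2)).comp_tendsto
    tendsto_natCast_atTop_atTop).def hδ
  filter_upwards [h, Filter.eventually_ge_atTop 1] with n hn hn1
  have hn0 : (0 : ℝ) < n := by exact_mod_cast hn1
  simp only [Function.comp_apply, Real.norm_eq_abs] at hn
  rw [← Real.sqrt_eq_rpow, abs_of_nonneg (Real.sqrt_nonneg _)] at hn
  rw [div_le_iff₀ (Real.sqrt_pos.2 hn0)]
  exact (le_abs_self _).trans hn

lemma eventually_abs_binTail_sub_stdGaussTail_le {c : ℝ} (hc : 0 < c) :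
    ∃ K : ℝ, 0 < K ∧ ∀ᶠ n : ℕ in Filter.atTop, ∀ k : ℤ, ∀ ε : ℝ, ε ∈ Set.Icc (-1 : ℝ) 1 →
      |ε| ≤ c * Real.sqrt (Real.logb 2 n / n) →
      |(k : ℝ)| < c * Real.sqrt (n * Real.logb 2 n) →
      |binTail n ε k - stdGaussTail (((k : ℝ) - ε * n) / Real.sqrt n)| ≤
        K * (Real.logb 2 n ^ ((3 : ℝ) / 2) / Real.sqrt n) *
          gaussKernel (((k : ℝ) - ε * n) / Real.sqrt n) := by
  have hl2 : 0 < Real.log 2 := Real.log_pos (by norm_num)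
  set b := c / Real.sqrt (Real.log 2) with hb
  have hb0 : 0 < b := div_pos hc (Real.sqrt_pos.2 hl2)
  obtain ⟨a, ha⟩ : ∃ a, a = 2 * b ^ 2 + b + 3 := ⟨_, rfl⟩
  have ha3 : 3 ≤ a := by rw [ha]; nlinarith
  have ha0 : 0 < a := by linarith
  refine ⟨224 * a ^ 3 + 46, by positivity, ?_⟩
  filter_upwards [eventually_log_rpow_div_sqrt_le (δ := 1 / (8 * a ^ 3)) (by positivity),
    Filter.eventually_ge_atTop 400] with n hD hn k ε hε hεn hkn
  have hn400 : (400 : ℝ) ≤ n := by exact_mod_cast hn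
  have hn0 : (0 : ℝ) < n := by linarith
  have hn1 : 1 ≤ n := by omega
  have hsq20 : 20 ≤ Real.sqrt n := Real.le_sqrt_of_sq_le (by linarith)
  have hsq : 0 < Real.sqrt n := by linarith
  have hlog : 1 ≤ Real.log n := by
    rw [Real.le_log_iff_exp_le hn0]
    linarith [Real.exp_one_lt_three]
  have hlog0 : 0 ≤ Real.log n := by linarith
  obtain ⟨r, hr⟩ : ∃ r, r = Real.sqrt (Real.log n / n) := ⟨_, rfl⟩
  have hr0 : 0 < r := by rw [hr]; exact Real.sqrt_pos.2 (by positivity)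
  have hr2 : n * r ^ 2 = Real.log n := by
    rw [hr, Real.sq_sqrt (by positivity)]
    field_simp
  have hr3 : n * r ^ 3 = Real.log n ^ ((3 : ℝ) / 2) / Real.sqrt n := by
    rw [rpow_three_halves hlog0, mul_div_assoc, ← Real.sqrt_div hlog0, ← hr, ← hr2]
    ring
  rw [← hr3] at hD
  have hnr : 2 ≤ n * r := by
    refine le_of_sq_le_sq ?_ (by positivity)
    rw [show (n * r) ^ 2 = n * (n * r ^ 2) by ring, hr2]
    nlinarith
  have har : a * r ≤ 1 / 2 := by
    have h1 : 2 * r ^ 2 ≤ 1 / (8 * a ^ 3) := by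
      refine le_trans ?_ hD
      nlinarith [mul_le_mul_of_nonneg_right hnr (sq_nonneg r)]
    rw [le_div_iff₀ (by positivity)] at h1
    refine le_of_sq_le_sq ?_ (by norm_num)
    nlinarith [sq_nonneg (a * r)]
  have hδ1 : 8 * a ^ 3 * (n * r ^ 3) ≤ 1 := by
    rw [le_div_iff₀ (by positivity)] at hD
    linarith
  have hεr : |ε| ≤ b * r := by
    refine hεn.trans_eq ?_
    unfold Real.logb
    rw [div_right_comm, Real.sqrt_div (by positivity), ← hr, hb]
    ring
  have hkr : |(k : ℝ)| ≤ b * n * r := by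
    refine hkn.le.trans_eq ?_
    unfold Real.logb
    rw [← mul_div_assoc, Real.sqrt_div (by positivity), ← hr2,
      show (n : ℝ) * (n * r ^ 2) = (n * r) ^ 2 by ring, Real.sqrt_sq (by positivity), hb]
    ring
  have hh : 2 / Real.sqrt n ≤ 1 / 10 := by
    rw [div_le_iff₀ hsq]
    linarith
  have hexp : Real.exp (-(n * r ^ 2)) ≤ 1 / Real.sqrt n := by
    rw [hr2, Real.exp_neg, Real.exp_log hn0, ← one_div]
    refine one_div_le_one_div_of_le hsq ?_
    nlinarith [Real.sq_sqrt hn0.le]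
  have hsn : 1 / Real.sqrt n ≤ n * r ^ 3 := by
    rw [hr3]
    exact div_le_div_of_nonneg_right (Real.one_le_rpow hlog (by norm_num)) hsq.le
  refine (abs_binTail_sub_stdGaussTail_le hn1 hb0 ha hr0 hε hεr hkr har hnr hδ1 hh hexp hsn).trans ?_
  refine mul_le_mul_of_nonneg_right (mul_le_mul_of_nonneg_left ?_ (by positivity))
    (gaussKernel_pos _).le
  rw [hr3]
  exact div_le_div_of_nonneg_right
    (Real.rpow_le_rpow hlog0 (log_le_logb_two n) (by norm_num)) hsq.le

/-- For `2 ≤ n ≤ N` the estimate holds with a constant depending on `N`. -/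
lemma abs_binTail_sub_stdGaussTail_le_of_le {c : ℝ} {n N : ℕ} (hn : 2 ≤ n)
    (hnN : n ≤ N) {k : ℤ} {ε : ℝ} (hε : ε ∈ Set.Icc (-1 : ℝ) 1)
    (hεn : |ε| ≤ c * Real.sqrt (Real.logb 2 n / n))
    (hkn : |(k : ℝ)| < c * Real.sqrt (n * Real.logb 2 n)) :
    |binTail n ε k - stdGaussTail (((k : ℝ) - ε * n) / Real.sqrt n)| ≤
      (Real.sqrt N * Real.exp (2 * c ^ 2 * N)) *
        (Real.logb 2 n ^ ((3 : ℝ) / 2) / Real.sqrt n) *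
          gaussKernel (((k : ℝ) - ε * n) / Real.sqrt n) := by
  have hn2 : (2 : ℝ) ≤ n := by exact_mod_cast hn
  have hn0 : (0 : ℝ) < n := by linarith
  have hnN' : (n : ℝ) ≤ N := by exact_mod_cast hnN
  have hsq : 0 < Real.sqrt n := Real.sqrt_pos.2 hn0
  obtain ⟨L, hL⟩ : ∃ L, L = Real.logb 2 n := ⟨_, rfl⟩
  rw [← hL] at hεn hkn ⊢
  have hL1 : 1 ≤ L := by
    rw [hL, Real.le_logb_iff_rpow_le (by norm_num) hn0]
    simpa using hn2
  have hLN : L ≤ N := by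
    rw [hL, Real.logb_le_iff_le_rpow (by norm_num) hn0, Real.rpow_natCast]
    have : n ≤ 2 ^ N := hnN.trans Nat.lt_two_pow_self.le
    exact_mod_cast this
  set x := ((k : ℝ) - ε * n) / Real.sqrt n with hx
  have hxabs : |x| ≤ 2 * c * Real.sqrt L := by
    rw [hx, abs_div, abs_of_pos hsq, div_le_iff₀ hsq]
    have h1 : Real.sqrt (n * L) = Real.sqrt n * Real.sqrt L := Real.sqrt_mul hn0.le L
    have h2 : Real.sqrt (L / n) * n = Real.sqrt n * Real.sqrt L := by
      rw [Real.sqrt_div (by linarith)]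
      rw [div_mul_eq_mul_div, div_eq_iff hsq.ne']
      linear_combination (-Real.sqrt L) * Real.mul_self_sqrt hn0.le
    have h3 : |ε * n| ≤ c * (Real.sqrt n * Real.sqrt L) := by
      rw [abs_mul, abs_of_pos hn0, ← h2, ← mul_assoc]
      exact mul_le_mul_of_nonneg_right hεn hn0.le
    rw [h1] at hkn
    linarith [abs_sub (k : ℝ) (ε * n)]
  have hker : Real.exp (-(2 * c ^ 2 * N)) ≤ gaussKernel x := by
    have : x ^ 2 ≤ (2 * c * Real.sqrt L) ^ 2 := sq_le_sq' (by linarith [(abs_le.1 hxabs).1])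
      (abs_le.1 hxabs).2
    rw [mul_pow, Real.sq_sqrt (by linarith)] at this
    exact Real.exp_le_exp.2 (by nlinarith [mul_le_mul_of_nonneg_left hLN (sq_nonneg c)])
  have hone : |binTail n ε k - stdGaussTail x| ≤ 1 := by
    have h1 := binTail_mem_Icc (n := n) hε k
    have h2 := stdGaussTail_nonneg x
    have h3 := stdGaussTail_le_one x
    rw [abs_le]
    constructor <;> linarith [h1.1, h1.2]
  have hpow : 1 / Real.sqrt n ≤ L ^ ((3 : ℝ) / 2) / Real.sqrt n :=
    div_le_div_of_nonneg_right (Real.one_le_rpow hL1 (by norm_num)) hsq.le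
  have hsqN : 1 ≤ Real.sqrt N * (1 / Real.sqrt n) := by
    rw [mul_one_div, one_le_div hsq]
    exact Real.sqrt_le_sqrt hnN'
  calc |binTail n ε k - stdGaussTail x| ≤ 1 := hone
    _ ≤ Real.sqrt N * (1 / Real.sqrt n) *
          (Real.exp (2 * c ^ 2 * N) * Real.exp (-(2 * c ^ 2 * N))) := by
        rw [← Real.exp_add, add_neg_cancel, Real.exp_zero, mul_one]
        exact hsqN
    _ ≤ Real.sqrt N * (L ^ ((3 : ℝ) / 2) / Real.sqrt n) *
          (Real.exp (2 * c ^ 2 * N) * gaussKernel x) := by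
        gcongr
    _ = _ := by ring

lemma exists_binTail_approx_const {c : ℝ} (hc : 0 < c) :
    ∃ K : ℝ, 0 < K ∧ ∀ n : ℕ, 1 ≤ n → ∀ k : ℤ, ∀ ε : ℝ, ε ∈ Set.Icc (-1 : ℝ) 1 →
      |ε| ≤ c * Real.sqrt (Real.logb 2 n / n) →
      |(k : ℝ)| < c * Real.sqrt (n * Real.logb 2 n) →
      |binTail n ε k - stdGaussTail (((k : ℝ) - ε * n) / Real.sqrt n)| ≤
        K * (Real.logb 2 n ^ ((3 : ℝ) / 2) / Real.sqrt n) *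
          gaussKernel (((k : ℝ) - ε * n) / Real.sqrt n) := by
  obtain ⟨K, hK, hev⟩ := eventually_abs_binTail_sub_stdGaussTail_le hc
  obtain ⟨N, hN⟩ := Filter.eventually_atTop.1 hev
  refine ⟨K + Real.sqrt N * Real.exp (2 * c ^ 2 * N), by positivity, fun n hn k ε hε hεn hkn => ?_⟩
  have hn0 : (1 : ℝ) ≤ n := by exact_mod_cast hn
  have hrate : 0 ≤ Real.logb 2 n ^ ((3 : ℝ) / 2) / Real.sqrt n :=
    div_nonneg (Real.rpow_nonneg (Real.logb_nonneg (by norm_num) hn0) _) (Real.sqrt_nonneg _)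
  have hmono : ∀ K', K' ≤ K + Real.sqrt N * Real.exp (2 * c ^ 2 * N) →
      K' * (Real.logb 2 n ^ ((3 : ℝ) / 2) / Real.sqrt n) *
          gaussKernel (((k : ℝ) - ε * n) / Real.sqrt n) ≤
        (K + Real.sqrt N * Real.exp (2 * c ^ 2 * N)) *
          (Real.logb 2 n ^ ((3 : ℝ) / 2) / Real.sqrt n) *
            gaussKernel (((k : ℝ) - ε * n) / Real.sqrt n) := fun K' hK' =>
    mul_le_mul_of_nonneg_right (mul_le_mul_of_nonneg_right hK' hrate) (gaussKernel_pos _).le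
  rcases le_total N n with h | h
  · exact (hN n h k ε hε hεn hkn).trans (hmono _ (le_add_of_nonneg_right (by positivity)))
  · have hn2 : 2 ≤ n := by
      by_contra hlt
      obtain rfl : n = 1 := by omega
      simp only [Nat.cast_one, Real.logb_one, mul_zero, Real.sqrt_zero] at hkn
      exact absurd hkn (not_lt.2 (abs_nonneg _))
    exact (abs_binTail_sub_stdGaussTail_le_of_le hn2 h hε hεn hkn).trans
      (hmono _ (by linarith))

theorem stmt_6 :
    ∃ φ : ℝ → ℝ, (∀ c : ℝ, 0 < c → 0 < φ c) ∧
      ∀ c : ℝ, 0 < c → ∀ n : ℕ, 1 ≤ n → ∀ k : ℤ, ∀ ε : ℝ, ε ∈ Set.Icc (-1 : ℝ) 1 →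
        |ε| ≤ c * Real.sqrt (Real.logb 2 n / n) →
        |(k : ℝ)| < c * Real.sqrt (n * Real.logb 2 n) →
        |binTail n ε k - stdGaussTail (((k : ℝ) - ε * n) / Real.sqrt n)| ≤
          φ c * (Real.logb 2 n ^ ((3 : ℝ) / 2) / Real.sqrt n) *
            Real.exp (-((k : ℝ) - ε * n) ^ 2 / (2 * n)) := by
  choose! φ hφ hbound using fun (c : ℝ) (hc : 0 < c) => exists_binTail_approx_const hc
  refine ⟨φ, hφ, fun c hc n hn k ε hε hεn hkn => ?_⟩
  have hker : gaussKernel (((k : ℝ) - ε * n) / Real.sqrt n) =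
      Real.exp (-((k : ℝ) - ε * n) ^ 2 / (2 * n)) := by
    unfold gaussKernel
    rw [div_pow, Real.sq_sqrt (Nat.cast_nonneg n)]
    congr 1
    ring
  rw [← hker]
  exact hbound c hc n hn k ε hε hεn hkn
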